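/- Let (φ,σ) be a minimal action of the infinite dihedral group ℤ⋊ℤ₂ on a Cantor set X and let Y ⊆ X be a nonempty clopen set with σ(Y) = Y. Then there exist a partition of Y into clopen sets Y_1,…,Y_K and positive integers J_1 < J_2 < … < J_K such that {φ^k(Y_i) : i = 1,…,K, k = 0,…,J_i−1} is a partition of X, and σ(φ^{J_i}(Y_i)) = Y_i for each i = 1,…,K. -/

import Mathlib

open Set

/-- The points of `Y` whose first return time to `Y` under `e` is `n`. -/
def firstReturnSet {X : Type*} (e : Equiv.Perm X) (Y : Set X) (n : ℕ) : Set X :=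
  {y | y ∈ Y ∧ (e ^ n) y ∈ Y ∧ ∀ m, 0 < m → m < n → (e ^ m) y ∉ Y}

theorem Homeomorph.continuous_toEquiv_pow {X : Type*} [TopologicalSpace X] (φ : X ≃ₜ X) (n : ℕ) :
    Continuous ((φ.toEquiv : Equiv.Perm X) ^ n) := by
  rw [← Equiv.Perm.iterate_eq_pow]
  exact φ.continuous.iterate n

theorem Homeomorph.continuous_toEquiv_zpow {X : Type*} [TopologicalSpace X] (φ : X ≃ₜ X) (n : ℤ) :
    Continuous ((φ.toEquiv : Equiv.Perm X) ^ n) := by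
  obtain ⟨k, rfl | rfl⟩ := n.eq_nat_or_neg
  · rw [zpow_natCast]
    exact φ.continuous_toEquiv_pow k
  · rw [zpow_neg, zpow_natCast, ← inv_pow]
    exact φ.symm.continuous_toEquiv_pow k

theorem isClopen_firstReturnSet {X : Type*} [TopologicalSpace X] (φ : X ≃ₜ X) {Y : Set X}
    (hY : IsClopen Y) (n : ℕ) : IsClopen (firstReturnSet φ.toEquiv Y n) := by
  have h : firstReturnSet φ.toEquiv Y n =
      Y ∩ ((φ.toEquiv : Equiv.Perm X) ^ n) ⁻¹' Y ∩
        ⋂ m ∈ Finset.Ioo 0 n, (((φ.toEquiv : Equiv.Perm X) ^ m) ⁻¹' Y)ᶜ := by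
    ext y
    simp only [firstReturnSet, mem_ofPred_eq, mem_inter_iff, mem_preimage, mem_iInter,
      Finset.mem_Ioo, mem_compl_iff, and_imp, and_assoc]
  rw [h]
  exact (hY.inter (hY.preimage (φ.continuous_toEquiv_pow n))).inter
    (isClopen_biInter_finset fun m _ => (hY.preimage (φ.continuous_toEquiv_pow m)).compl)

theorem eq_of_mem_firstReturnSet {X : Type*} {e : Equiv.Perm X} {Y : Set X} {m n : ℕ} {y : X}
    (hm : 0 < m) (hn : 0 < n) (h : y ∈ firstReturnSet e Y m) (h' : y ∈ firstReturnSet e Y n) :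
    m = n := by
  rcases lt_trichotomy m n with hlt | heq | hlt
  · exact absurd h.2.1 (h'.2.2 m hm hlt)
  · exact heq
  · exact absurd h'.2.1 (h.2.2 n hn hlt)

theorem exists_mem_firstReturnSet {X : Type*} {e : Equiv.Perm X} {Y : Set X} {N : ℕ} {y : X}
    (hy : y ∈ Y) (h : ∃ n, 0 < n ∧ n ≤ N ∧ (e ^ n) y ∈ Y) :
    ∃ n, 0 < n ∧ n ≤ N ∧ y ∈ firstReturnSet e Y n := by
  classical
  have hs := Nat.find_spec h
  refine ⟨Nat.find h, hs.1, hs.2.1, hy, hs.2.2, fun m hm hlt hmem => ?_⟩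
  exact Nat.find_min h hlt ⟨hm, hlt.le.trans hs.2.1, hmem⟩

/-- If `y` is still on its first excursion from `Y` at time `k`, then no point of `Y` reaches
`e ^ k` applied to `y` in fewer than `k` steps. -/
theorem le_of_pow_eq_pow_of_mem_firstReturnSet {X : Type*} {e : Equiv.Perm X} {Y : Set X}
    {m k l : ℕ} {y z : X} (hy : y ∈ firstReturnSet e Y m) (hz : z ∈ Y) (hk : k < m)
    (h : (e ^ k) y = (e ^ l) z) : k ≤ l := by
  by_contra! hlt
  obtain ⟨d, rfl⟩ := Nat.exists_eq_add_of_lt hlt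
  refine hy.2.2 (d + 1) (by omega) (by omega) ?_
  have : (e ^ l) ((e ^ (d + 1)) y) = (e ^ l) z := by
    rw [← h, ← Equiv.Perm.mul_apply, ← pow_add, add_assoc]
  rwa [(e ^ l).injective this]

/-- A clopen set invariant under the flip is visited by every orbit of the shift, in bounded
positive time. -/
theorem exists_bound_pow_mem {X : Type*} [TopologicalSpace X] [CompactSpace X]
    (φ σ : X ≃ₜ X)
    (hpow : ∀ (n : ℤ) (x : X), σ (((φ.toEquiv : Equiv.Perm X) ^ n) (σ x)) =
      ((φ.toEquiv : Equiv.Perm X) ^ (-n)) x)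
    (hmin : ∀ x : X,
      Dense {y : X | ∃ (n : ℤ) (i : Bool), y = (φ.toEquiv ^ n) (cond i (σ x) x)})
    {Y : Set X} (hY : IsClopen Y) (hYne : Y.Nonempty) (hYσ : ∀ x ∈ Y, σ x ∈ Y) :
    ∃ N : ℕ, ∀ x, ∃ n, 0 < n ∧ n ≤ N ∧ ((φ.toEquiv : Equiv.Perm X) ^ n) x ∈ Y := by
  set e : Equiv.Perm X := φ.toEquiv
  have hvisit : ∀ x, ∃ n : ℤ, (e ^ n) x ∈ Y := by
    intro x
    obtain ⟨y, hyY, n, i, rfl⟩ := (hmin x).inter_open_nonempty Y hY.isOpen hYne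
    cases i
    · exact ⟨n, hyY⟩
    · exact ⟨-n, hpow n x ▸ hYσ _ hyY⟩
  obtain ⟨t, ht⟩ := isCompact_univ.elim_finite_subcover (fun n : ℤ => (e ^ n) ⁻¹' Y)
    (fun n => hY.isOpen.preimage (φ.continuous_toEquiv_zpow n))
    (fun x _ => mem_iUnion.2 (hvisit x))
  obtain ⟨M, hM⟩ : ∃ M : ℕ, ∀ n ∈ t, n.natAbs ≤ M :=
    ⟨t.sup Int.natAbs, fun n hn => Finset.le_sup (f := Int.natAbs) hn⟩
  refine ⟨2 * M + 1, fun x => ?_⟩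
  obtain ⟨n, hn, hmem⟩ := mem_iUnion₂.1 (ht (mem_univ ((e ^ ((M : ℤ) + 1)) x)))
  have hnM := hM n hn
  refine ⟨(n + (M + 1)).toNat, by omega, by omega, ?_⟩
  rw [mem_preimage, ← Equiv.Perm.mul_apply, ← zpow_add] at hmem
  rwa [← zpow_natCast, Int.toNat_of_nonneg (by omega)]

theorem mapsTo_flip_firstReturnSet {X : Type*} {e : Equiv.Perm X} {σ : X → X}
    (hσ : ∀ x, σ (σ x) = x) (hpow : ∀ (n : ℤ) (x : X), σ ((e ^ n) (σ x)) = (e ^ (-n)) x)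
    {Y : Set X} (hYσ : ∀ x ∈ Y, σ x ∈ Y) {n : ℕ} {y : X} (hy : y ∈ firstReturnSet e Y n) :
    σ ((e ^ n) y) ∈ firstReturnSet e Y n := by
  have key : ∀ m ≤ n, (e ^ m) (σ ((e ^ n) y)) = σ ((e ^ (n - m)) y) := by
    intro m hm
    rw [← hσ ((e ^ m) (σ ((e ^ n) y))), ← zpow_natCast e m, hpow, ← zpow_natCast e n,
      ← Equiv.Perm.mul_apply, ← zpow_add, ← zpow_natCast e (n - m), Nat.cast_sub hm,
      neg_add_eq_sub]
  refine ⟨hYσ _ hy.2.1, ?_, fun m hm hlt hmem => ?_⟩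
  · rw [key n le_rfl]
    simpa using hYσ _ hy.1
  · rw [key m hlt.le] at hmem
    exact hy.2.2 (n - m) (by omega) (by omega) (by simpa [hσ] using hYσ _ hmem)


/-- Kakutani–Rokhlin partitions for minimal `ℤ ⋊ ℤ₂`-actions: given a minimal action
`α = (φ, σ)` of the infinite dihedral group on a Cantor set `X` and a nonempty clopen
`Y ⊆ X` with `σ(Y) = Y`, there is a partition of `Y` into clopen sets `Y₁, …, Y_K` and
positive integers `J₁ < ⋯ < J_K` such that `{φᵏ(Yᵢ) : 1 ≤ i ≤ K, 0 ≤ k ≤ Jᵢ - 1}` is a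
partition of `X` and `σ(φ^{Jᵢ}(Yᵢ)) = Yᵢ` for each `i`. -/
theorem dihedral_minimal_kakutani_rokhlin {X : Type*} [TopologicalSpace X] [CompactSpace X]
    [TopologicalSpace.MetrizableSpace X] [TotallyDisconnectedSpace X] [PerfectSpace X]
    [Nonempty X] (φ σ : X ≃ₜ X)
    (hσ : ∀ x, σ (σ x) = x) (hrel : ∀ x, σ (φ (σ x)) = φ.symm x)
    (hmin : ∀ x : X,
      Dense {y : X | ∃ (n : ℤ) (i : Bool), y = (φ.toEquiv ^ n) (cond i (σ x) x)})
    (Y : Set X) (hY : IsClopen Y) (hYne : Y.Nonempty) (hYσ : σ '' Y = Y) :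
    ∃ (K : ℕ) (V : Fin K → Set X) (J : Fin K → ℕ),
      (∀ i, IsClopen (V i)) ∧ (∀ i, (V i).Nonempty) ∧
      (∀ i, 0 < J i) ∧ StrictMono J ∧
      (∀ i j, i ≠ j → Disjoint (V i) (V j)) ∧ (⋃ i, V i) = Y ∧
      (∀ x : X, ∃! p : (i : Fin K) × Fin (J i), x ∈ (φ.toEquiv ^ (p.2 : ℕ)) '' V p.1) ∧
      (∀ i, σ '' ((φ.toEquiv ^ (J i)) '' V i) = V i) := by
  classical
  set e : Equiv.Perm X := φ.toEquiv
  have hYσ' : ∀ x ∈ Y, σ x ∈ Y := fun x hx => hYσ ▸ mem_image_of_mem σ hx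
  have hpow : ∀ (n : ℤ) (x : X), σ ((e ^ n) (σ x)) = (e ^ (-n)) x := by
    have hs : (σ.toEquiv : Equiv.Perm X)⁻¹ = σ.toEquiv :=
      inv_eq_of_mul_eq_one_left (Equiv.ext hσ)
    have hconj : (σ.toEquiv : Equiv.Perm X) * e * (σ.toEquiv : Equiv.Perm X)⁻¹ = e⁻¹ := by
      rw [hs]
      exact Equiv.ext hrel
    intro n x
    have h := conj_zpow (i := n) (a := (σ.toEquiv : Equiv.Perm X)) (b := e)
    rw [hconj, hs, inv_zpow'] at h
    exact (DFunLike.congr_fun h x).symm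
  obtain ⟨N, hN⟩ := exists_bound_pow_mem φ σ hpow hmin hY hYne hYσ'
  set S : Finset ℕ := {n ∈ Finset.Icc 1 N | (firstReturnSet e Y n).Nonempty}
  let J : Fin S.card → ℕ := fun i => S.orderEmbOfFin rfl i
  have hJS : ∀ i, J i ∈ S := fun i => S.orderEmbOfFin_mem rfl i
  have hJpos : ∀ i, 0 < J i := fun i => (Finset.mem_Icc.1 (Finset.mem_filter.1 (hJS i)).1).1
  have hcover : ∀ y ∈ Y, ∃ i, y ∈ firstReturnSet e Y (J i) := by
    intro y hy
    obtain ⟨n, hn0, hnN, hn⟩ := exists_mem_firstReturnSet hy (hN y)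
    have hnS : n ∈ S := Finset.mem_filter.2 ⟨Finset.mem_Icc.2 ⟨hn0, hnN⟩, y, hn⟩
    have hr : n ∈ range (S.orderEmbOfFin rfl) := by
      rw [Finset.range_orderEmbOfFin]
      exact hnS
    obtain ⟨i, rfl⟩ := hr
    exact ⟨i, hn⟩
  have hJmono : StrictMono J := (S.orderEmbOfFin rfl).strictMono
  have hidx : ∀ i j y, y ∈ firstReturnSet e Y (J i) → y ∈ firstReturnSet e Y (J j) → i = j :=
    fun i j y hi hj => hJmono.injective (eq_of_mem_firstReturnSet (hJpos i) (hJpos j) hi hj)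
  refine ⟨S.card, fun i => firstReturnSet e Y (J i), J,
    fun i => isClopen_firstReturnSet φ hY _, fun i => (Finset.mem_filter.1 (hJS i)).2, hJpos,
    hJmono, fun i j hij => disjoint_left.2 fun y hi hj => hij (hidx i j y hi hj), ?_, ?_, ?_⟩
  · ext y
    rw [mem_iUnion]
    exact ⟨fun ⟨i, hi⟩ => hi.1, hcover y⟩
  · intro x
    have hback : ∃ k : ℕ, (e ^ (-(k : ℤ))) x ∈ Y := by
      obtain ⟨k, -, -, hk⟩ := hN (σ x)
      exact ⟨k, hpow k x ▸ hYσ' _ hk⟩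
    set k := Nat.find hback
    have hkY : (e ^ (-(k : ℤ))) x ∈ Y := Nat.find_spec hback
    set y := (e ^ (-(k : ℤ))) x with hy
    have hyx : (e ^ k) y = x := by simp [hy]
    obtain ⟨i, hi⟩ := hcover y hkY
    have hki : k < J i := by
      by_contra! hle
      have hlt : k - J i < k := by have := hJpos i; omega
      refine Nat.find_min hback hlt ?_
      have := hi.2.1
      rw [hy, ← zpow_natCast, ← Equiv.Perm.mul_apply, ← zpow_add] at this
      rwa [Nat.cast_sub hle, neg_sub, sub_eq_add_neg]
    refine ⟨⟨i, k, hki⟩, ⟨y, hi, hyx⟩, ?_⟩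
    rintro ⟨j, l, hl⟩ ⟨z, hz, hzx⟩
    have hzy : (e ^ l) z = (e ^ k) y := hzx.trans hyx.symm
    have hlk : l = k := le_antisymm
      (le_of_pow_eq_pow_of_mem_firstReturnSet hz hi.1 hl hzy)
      (le_of_pow_eq_pow_of_mem_firstReturnSet hi hz.1 hki hzy.symm)
    rw [hlk] at hzy
    rw [(e ^ k).injective hzy] at hz
    obtain rfl := hidx i j _ hi hz
    simp [hlk]
  · intro i
    have hmaps : ∀ y ∈ firstReturnSet e Y (J i), σ ((e ^ J i) y) ∈ firstReturnSet e Y (J i) :=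
      fun y hy => mapsTo_flip_firstReturnSet hσ hpow hYσ' hy
    refine Subset.antisymm ?_ fun y hy => ?_
    · rintro _ ⟨_, ⟨y, hy, rfl⟩, rfl⟩
      exact hmaps y hy
    · refine ⟨_, ⟨_, hmaps y hy, rfl⟩, ?_⟩
      have h := hpow (J i) ((e ^ J i) y)
      simpa using h
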